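/- arXiv:2506.07186 — 2 statements merged into one kernel-verified Lean document; each statement's English description precedes it below -/
import Mathlib

section
/- Nested value-set iteration (Lemma 4.6): Define the sequence of value-set functions 𝒱^0, 𝒱^1, … by 𝒱^0(s) = B = [−1/2, 1/2]^{n+1} for all s ∈ S and 𝒱^{k+1} = Φ(𝒱^k). Then for every k ∈ ℕ, 𝒱^k ⊇ 𝒱^{k+1} ⊇ 𝒱*, i.e., 𝒱^k(s) ⊇ 𝒱^{k+1}(s) ⊇ 𝒱*(s) for every state s. -/
open Finset

/-- A probability mass function on a finite type, as a predicate. -/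
def IsDist {X : Type*} [Fintype X] (f : X → ℝ) : Prop :=
  (∀ x, 0 ≤ f x) ∧ ∑ x, f x = 1

/-- Data of a stochastic game with a principal (player `0`) and `n` agents
(players `1,…,n`): initial state, discount factor, transition function and
reward functions. -/
structure Game (S A : Type*) (n : ℕ) where
  sInit : S
  gamma : ℝ
  p : S → (Fin (n + 1) → A) → S → ℝ
  r : Fin (n + 1) → S → (Fin (n + 1) → A) → ℝ

/-- Validity of the game data: `γ ∈ [0,1)`, transitions are probability
distributions, and rewards lie in `[-(1-γ)/2, (1-γ)/2]`. -/
def Game.Valid {S A : Type*} [Fintype S] {n : ℕ} (G : Game S A n) : Prop :=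
  0 ≤ G.gamma ∧ G.gamma < 1 ∧ (∀ s a, IsDist (G.p s a)) ∧
    ∀ i s a, |G.r i s a| ≤ (1 - G.gamma) / 2

/-- Histories: finite sequences of (state, recommended joint action, played joint action). -/
abbrev Hist (S A : Type*) (n : ℕ) :=
  List (S × (Fin (n + 1) → A) × (Fin (n + 1) → A))

/-- A (history-dependent) correlation policy assigns a probability distribution on
joint actions to every history and current state. -/
def IsPolicy {S A : Type*} [Fintype A] {n : ℕ}
    (π : Hist S A n → S → (Fin (n + 1) → A) → ℝ) : Prop :=
  ∀ σ s, IsDist (π σ s)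

/-- The trivial deviation plan (no deviation). -/
def noDev {S A : Type*} {n : ℕ} : Hist S A n → S → A → A := fun _ _ a => a

/-- `IsValueFn G π i ρ V Q` says that `V` and `Q` are bounded functions satisfying
the Bellman-type recursion defining the V- and Q-values induced by the policy `π`
together with the deviation plan `ρ` of agent `i`. -/
def IsValueFn {S A : Type*} [Fintype S] [Fintype A] {n : ℕ}
    (G : Game S A n) (π : Hist S A n → S → (Fin (n + 1) → A) → ℝ)
    (i : Fin (n + 1)) (ρ : Hist S A n → S → A → A)
    (V : Hist S A n → S → Fin (n + 1) → ℝ)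
    (Q : Hist S A n → S → (Fin (n + 1) → A) → Fin (n + 1) → ℝ) : Prop :=
  (∃ C : ℝ, ∀ σ s j, |V σ s j| ≤ C) ∧
  (∀ σ s j, V σ s j = ∑ a : Fin (n + 1) → A, π σ s a * Q σ s a j) ∧
  (∀ σ s (a : Fin (n + 1) → A) j,
    Q σ s a j =
      G.r j s (Function.update a i (ρ σ s (a i))) +
        G.gamma * ∑ s', G.p s (Function.update a i (ρ σ s (a i))) s' *
          V (σ ++ [(s, a, Function.update a i (ρ σ s (a i)))]) s' j)

/-- `π` is a `δ`-correlated equilibrium: it is a policy, and for every agent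
`i ∈ {1,…,n}`, every history, state and recommended action, no deviation plan
improves the agent's conditional value by more than `δ`. -/
def IsCE {S A : Type*} [Fintype S] [Fintype A] [DecidableEq A] {n : ℕ}
    (G : Game S A n) (δ : ℝ)
    (π : Hist S A n → S → (Fin (n + 1) → A) → ℝ) : Prop :=
  IsPolicy π ∧
  ∀ V Q, IsValueFn G π 0 noDev V Q →
    ∀ i : Fin (n + 1), i ≠ 0 →
      ∀ (ρ : Hist S A n → S → A → A) Vρ Qρ, IsValueFn G π i ρ Vρ Qρ →
        ∀ (σ : Hist S A n) (s : S) (a : A),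
          ∑ av ∈ univ.filter (fun av : Fin (n + 1) → A => av i = a),
              π σ s av * Q σ s av i ≥
            ∑ av ∈ univ.filter (fun av : Fin (n + 1) → A => av i = a),
              π σ s av * Qρ σ s av i - δ

/-- A value vector `v` is `δ`-inducible at state `s` if `v = V^π(s)` for some `δ`-CE `π`. -/
def Inducible {S A : Type*} [Fintype S] [Fintype A] [DecidableEq A] {n : ℕ}
    (G : Game S A n) (δ : ℝ) (s : S) (v : Fin (n + 1) → ℝ) : Prop :=
  ∃ π V Q, IsCE G δ π ∧ IsValueFn G π 0 noDev V Q ∧ V [] s = v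

/-- The inducible value set `𝒱*(s)`: all values inducible (by exact CEs) at `s`. -/
def Vstar {S A : Type*} [Fintype S] [Fintype A] [DecidableEq A] {n : ℕ}
    (G : Game S A n) : S → Set (Fin (n + 1) → ℝ) :=
  fun s => {v | Inducible G 0 s v}

/-- One-step Bellman value of a stage distribution `pb` and onward values `w`. -/
def Bellman {S A : Type*} [Fintype S] [Fintype A] {n : ℕ}
    (G : Game S A n) (s : S) (pb : (Fin (n + 1) → A) → ℝ)
    (w : (Fin (n + 1) → A) → (Fin (n + 1) → A) → S → Fin (n + 1) → ℝ) :
    Fin (n + 1) → ℝ :=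
  fun j => ∑ a : Fin (n + 1) → A,
    pb a * (G.r j s a + G.gamma * ∑ s', G.p s a s' * w a a s' j)

/-- The incentive-compatibility constraint for a stage distribution `pb` and
onward values `w` at state `s`. -/
def ICC {S A : Type*} [Fintype S] [Fintype A] [DecidableEq A] {n : ℕ}
    (G : Game S A n) (s : S) (pb : (Fin (n + 1) → A) → ℝ)
    (w : (Fin (n + 1) → A) → (Fin (n + 1) → A) → S → Fin (n + 1) → ℝ) : Prop :=
  ∀ i : Fin (n + 1), i ≠ 0 → ∀ a b : A,
    ∑ av ∈ univ.filter (fun av : Fin (n + 1) → A => av i = a),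
        pb av * (G.r i s av + G.gamma * ∑ s', G.p s av s' * w av av s' i) ≥
      ∑ av ∈ univ.filter (fun av : Fin (n + 1) → A => av i = a),
        pb av * (G.r i s (Function.update av i b) +
          G.gamma * ∑ s', G.p s (Function.update av i b) s' *
            w av (Function.update av i b) s' i)

/-- The feasible set `F_s(𝒱)` of pairs `(pb, w)`. -/
def Feas {S A : Type*} [Fintype S] [Fintype A] [DecidableEq A] {n : ℕ}
    (G : Game S A n) (s : S) (VS : S → Set (Fin (n + 1) → ℝ)) :
    Set (((Fin (n + 1) → A) → ℝ) ×
      ((Fin (n + 1) → A) → (Fin (n + 1) → A) → S → Fin (n + 1) → ℝ)) :=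
  {pw | IsDist pw.1 ∧ ICC G s pw.1 pw.2 ∧ ∀ a b s', pw.2 a b s' ∈ VS s'}

/-- The update map `Φ` on value-set functions. -/
def Phi {S A : Type*} [Fintype S] [Fintype A] [DecidableEq A] {n : ℕ}
    (G : Game S A n) (VS : S → Set (Fin (n + 1) → ℝ)) :
    S → Set (Fin (n + 1) → ℝ) :=
  fun s => {v | ∃ pb w, (pb, w) ∈ Feas G s VS ∧ v = Bellman G s pb w}

/-- The hypercube `B = [-1/2, 1/2]^{n+1}`. -/
def cube (n : ℕ) : Set (Fin (n + 1) → ℝ) := {v | ∀ i, |v i| ≤ 1 / 2}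

/-- The `ξ`-neighborhood (in `‖·‖_∞`) of a set of value vectors. -/
def neigh {n : ℕ} (ξ : ℝ) (X : Set (Fin (n + 1) → ℝ)) : Set (Fin (n + 1) → ℝ) :=
  {v' | ∃ v ∈ X, ∀ i, |v' i - v i| ≤ ξ}

/-- The grid `G_ξ` of vectors whose coordinates are integer multiples of `ξ`. -/
def grid (n : ℕ) (ξ : ℝ) : Set (Fin (n + 1) → ℝ) :=
  {v | ∀ i, ∃ m : ℤ, v i = ξ * (m : ℝ)}

/-- The approximate update map `Φ̂`. -/
def PhiHat {S A : Type*} [Fintype S] [Fintype A] [DecidableEq A] {n : ℕ}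
    (G : Game S A n) (ξ : ℝ) (VS : S → Set (Fin (n + 1) → ℝ)) :
    S → Set (Fin (n + 1) → ℝ) :=
  fun s => convexHull ℝ (neigh ξ (Phi G VS s) ∩ grid n ξ)

/-- Pushing a new state into a `λ`-step memory. -/
def shiftMem {S : Type*} {lam : ℕ} (m : Fin lam → Option S) (s : S) :
    Fin lam → Option S :=
  fun j => if (j : ℕ) = 0 then some s
    else m ⟨(j : ℕ) - 1, lt_of_le_of_lt (Nat.sub_le _ _) j.isLt⟩

/-- The `λ`-memory meta-game: meta-states record the current state together with
the previous `λ` states (with `none` as placeholder). -/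
def metaGame {S A : Type*} [DecidableEq S] {n : ℕ} (G : Game S A n) (lam : ℕ) :
    Game ((Fin lam → Option S) × S) A n where
  sInit := (fun _ => none, G.sInit)
  gamma := G.gamma
  p := fun x a x' => if x'.1 = shiftMem x.1 x.2 then G.p x.2 a x'.2 else 0
  r := fun i x a => G.r i x.2 a

/-- The game is `c`-turn-based with acting-player sets `I s` (always containing
the principal `0`): rewards and transitions only depend on acting players' actions. -/
def TurnBased {S A : Type*} {n : ℕ} (G : Game S A n) (c : ℕ)
    (I : S → Finset (Fin (n + 1))) : Prop :=
  (∀ s, (I s).card ≤ c) ∧ (∀ s, (0 : Fin (n + 1)) ∈ I s) ∧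
    ∀ s (a a' : Fin (n + 1) → A), (∀ i ∈ I s, a i = a' i) →
      (∀ j, G.r j s a = G.r j s a') ∧ ∀ s', G.p s a s' = G.p s a' s'

/-- The set of acting players recorded in a meta-state. -/
def metaI {S : Type*} {n lam : ℕ} (I : S → Finset (Fin (n + 1)))
    (x : (Fin lam → Option S) × S) : Finset (Fin (n + 1)) :=
  I x.2 ∪ Finset.univ.biUnion fun j : Fin lam => (x.1 j).elim ∅ I

/-- The relaxed neighborhood `neigh_{ξ₂}^{Ix}`: coordinates in `Ix` must stay
`ξ₂`-close, the others are only required to lie in `neigh_{ξ₂}(B)`. -/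
def neighI {n : ℕ} (ξ₂ : ℝ) (Ix : Finset (Fin (n + 1)))
    (X : Set (Fin (n + 1) → ℝ)) : Set (Fin (n + 1) → ℝ) :=
  {v' | v' ∈ neigh ξ₂ (cube n) ∧ ∃ v ∈ X, ∀ i ∈ Ix, |v' i - v i| ≤ ξ₂}

/-- The turn-based approximate update map `Φ^TB` on value-set functions of the
`λ`-memory meta-game. -/
def PhiTB {S A : Type*} [Fintype S] [Fintype A] [DecidableEq S] [DecidableEq A]
    {n : ℕ} (G : Game S A n) (lam : ℕ) (I : S → Finset (Fin (n + 1))) (ξ : ℝ)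
    (VS : ((Fin lam → Option S) × S) → Set (Fin (n + 1) → ℝ)) :
    ((Fin lam → Option S) × S) → Set (Fin (n + 1) → ℝ) :=
  fun x => convexHull ℝ
    (neighI (ξ / 2) (metaI I x) (Phi (metaGame G lam) VS x) ∩ grid n (ξ / 2))

/-- The auxiliary value function of the repeated 2×2 zero-sum subgame. -/
noncomputable def vfun (x y : ℝ) : ℝ :=
  (x * y + 2 * (1 - x) * (1 - y)) / (1 - x * y / 2 - (1 - x) * (1 - y) / 2)

lemma IsDist.abs_sum_le {X : Type*} [Fintype X] {f g : X → ℝ} {C : ℝ} (hf : IsDist f)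
    (hg : ∀ x, |g x| ≤ C) : |∑ x, f x * g x| ≤ C :=
  calc |∑ x, f x * g x| ≤ ∑ x, |f x * g x| := abs_sum_le_sum_abs _ _
    _ ≤ ∑ x, f x * C := sum_le_sum fun x _ => by
        rw [abs_mul, abs_of_nonneg (hf.1 x)]
        exact mul_le_mul_of_nonneg_left (hg x) (hf.1 x)
    _ = C := by rw [← sum_mul, hf.2, one_mul]

open Classical in
/-- The deviation plan that follows `ρ` after the first history entry `h₀` and is trivial
elsewhere. -/
noncomputable def devAfter {S A : Type*} {n : ℕ}
    (h₀ : S × (Fin (n + 1) → A) × (Fin (n + 1) → A))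
    (ρ : Hist S A n → S → A → A) : Hist S A n → S → A → A
  | [] => fun _ a => a
  | h :: σ => if h = h₀ then ρ σ else fun _ a => a

lemma devAfter_noDev {S A : Type*} {n : ℕ}
    (h₀ : S × (Fin (n + 1) → A) × (Fin (n + 1) → A)) :
    devAfter h₀ (noDev (S := S) (A := A) (n := n)) = noDev := by
  funext σ
  cases σ with
  | nil => rfl
  | cons h σ => exact ite_self _

section

variable {S A : Type*} [Fintype S] {n : ℕ} {G : Game S A n}

lemma Game.Valid.abs_stage_le (hG : G.Valid) {C : ℝ} (s : S)
    (a : Fin (n + 1) → A) (j : Fin (n + 1)) {w : S → ℝ} (hw : ∀ s', |w s'| ≤ C) :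
    |G.r j s a + G.gamma * ∑ s', G.p s a s' * w s'| ≤ (1 - G.gamma) / 2 + G.gamma * C := by
  obtain ⟨h0, -, hp, hr⟩ := hG
  refine (abs_add_le _ _).trans (add_le_add (hr j s a) ?_)
  rw [abs_mul, abs_of_nonneg h0]
  exact mul_le_mul_of_nonneg_left ((hp s a).abs_sum_le hw) h0

variable [Fintype A]

lemma IsValueFn.noDev_congr {π : Hist S A n → S → (Fin (n + 1) → A) → ℝ} {i : Fin (n + 1)}
    {V : Hist S A n → S → Fin (n + 1) → ℝ}
    {Q : Hist S A n → S → (Fin (n + 1) → A) → Fin (n + 1) → ℝ}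
    (h : IsValueFn G π i noDev V Q) (i' : Fin (n + 1)) : IsValueFn G π i' noDev V Q :=
  ⟨h.1, h.2.1, fun σ s a j => by simpa [noDev] using h.2.2 σ s a j⟩

lemma IsValueFn.abs_le_half (hG : G.Valid) {π : Hist S A n → S → (Fin (n + 1) → A) → ℝ}
    (hπ : IsPolicy π) {i : Fin (n + 1)} {ρ : Hist S A n → S → A → A}
    {V : Hist S A n → S → Fin (n + 1) → ℝ}
    {Q : Hist S A n → S → (Fin (n + 1) → A) → Fin (n + 1) → ℝ}
    (h : IsValueFn G π i ρ V Q) (σ : Hist S A n) (s : S) (j : Fin (n + 1)) :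
    |V σ s j| ≤ 1 / 2 := by
  obtain ⟨⟨C, hC⟩, hV, hQ⟩ := h
  have key : ∀ m : ℕ, ∀ σ s j, |V σ s j| ≤ 1 / 2 + G.gamma ^ m * |C| := by
    intro m
    induction m with
    | zero => exact fun σ s j => by linarith [hC σ s j, le_abs_self C, pow_zero G.gamma]
    | succ m ih =>
      intro σ s j
      rw [hV]
      refine (hπ σ s).abs_sum_le fun a => ?_
      rw [hQ]
      refine (hG.abs_stage_le _ _ _ fun s' => ih _ s' j).trans (le_of_eq ?_)
      ring
  have hlim : Filter.Tendsto (fun m : ℕ => 1 / 2 + G.gamma ^ m * |C|) Filter.atTop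
      (nhds (1 / 2 + 0 * |C|)) :=
    ((tendsto_pow_atTop_nhds_zero_of_lt_one hG.1 hG.2.1).mul_const _).const_add _
  simpa using ge_of_tendsto' hlim fun m => key m σ s j

/-- Value functions on nonempty histories extend to the empty history by one Bellman step. -/
lemma exists_isValueFn_of_nonempty {π : Hist S A n → S → (Fin (n + 1) → A) → ℝ}
    {i : Fin (n + 1)} {ρ : Hist S A n → S → A → A}
    {V : Hist S A n → S → Fin (n + 1) → ℝ}
    {Q : Hist S A n → S → (Fin (n + 1) → A) → Fin (n + 1) → ℝ}
    (hb : ∃ C : ℝ, ∀ h σ s j, |V (h :: σ) s j| ≤ C)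
    (hV : ∀ h σ s j, V (h :: σ) s j =
      ∑ a : Fin (n + 1) → A, π (h :: σ) s a * Q (h :: σ) s a j)
    (hQ : ∀ h σ s (a : Fin (n + 1) → A) j, Q (h :: σ) s a j =
      G.r j s (Function.update a i (ρ (h :: σ) s (a i))) +
        G.gamma * ∑ s', G.p s (Function.update a i (ρ (h :: σ) s (a i))) s' *
          V (h :: σ ++ [(s, a, Function.update a i (ρ (h :: σ) s (a i)))]) s' j) :
    ∃ V' Q', IsValueFn G π i ρ V' Q' ∧ (∀ h σ, V' (h :: σ) = V (h :: σ)) ∧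
      ∀ h σ, Q' (h :: σ) = Q (h :: σ) := by
  obtain ⟨C, hC⟩ := hb
  let Q₀ : S → (Fin (n + 1) → A) → Fin (n + 1) → ℝ := fun s a j =>
    G.r j s (Function.update a i (ρ [] s (a i))) +
      G.gamma * ∑ s', G.p s (Function.update a i (ρ [] s (a i))) s' *
        V [(s, a, Function.update a i (ρ [] s (a i)))] s' j
  let V₀ : S → Fin (n + 1) → ℝ := fun s j => ∑ a, π [] s a * Q₀ s a j
  refine ⟨fun σ => match σ with | [] => V₀ | h :: σ => V (h :: σ),
    fun σ => match σ with | [] => Q₀ | h :: σ => Q (h :: σ),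
    ⟨⟨max C (∑ s, ∑ j, |V₀ s j|), ?_⟩, ?_, ?_⟩, fun _ _ => rfl, fun _ _ => rfl⟩
  · rintro (_ | ⟨h, σ⟩) s j
    · refine le_max_of_le_right ?_
      exact (single_le_sum (f := fun j => |V₀ s j|) (fun _ _ => abs_nonneg _)
        (mem_univ j)).trans (single_le_sum (f := fun s => ∑ j, |V₀ s j|)
          (fun _ _ => sum_nonneg fun _ _ => abs_nonneg _) (mem_univ s))
    · exact le_max_of_le_left (hC h σ s j)
  · rintro (_ | ⟨h, σ⟩) s j
    · rfl
    · exact hV h σ s j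
  · rintro (_ | ⟨h, σ⟩) s a j
    · rfl
    · exact hQ h σ s a j

/-- A value function of the continuation policy after `h₀` is the restriction of a value function
of the whole policy. -/
lemma IsValueFn.exists_extend {π : Hist S A n → S → (Fin (n + 1) → A) → ℝ} {i : Fin (n + 1)}
    {ρ : Hist S A n → S → A → A} {V V' : Hist S A n → S → Fin (n + 1) → ℝ}
    {Q Q' : Hist S A n → S → (Fin (n + 1) → A) → Fin (n + 1) → ℝ}
    (h : IsValueFn G π i noDev V Q) (h₀ : S × (Fin (n + 1) → A) × (Fin (n + 1) → A))
    (h' : IsValueFn G (fun σ => π (h₀ :: σ)) i ρ V' Q') :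
    ∃ W R, IsValueFn G π i (devAfter h₀ ρ) W R ∧ ∀ σ, R (h₀ :: σ) = Q' σ := by
  classical
  obtain ⟨⟨C, hC⟩, hV, hQ⟩ := h
  obtain ⟨⟨C', hC'⟩, hV', hQ'⟩ := h'
  obtain ⟨W, R, hWR, -, hR⟩ := exists_isValueFn_of_nonempty (G := G) (π := π) (i := i)
    (ρ := devAfter h₀ ρ)
    (V := fun σ => match σ with
      | [] => V []
      | h :: σ => if h = h₀ then V' σ else V (h :: σ))
    (Q := fun σ => match σ with
      | [] => Q []
      | h :: σ => if h = h₀ then Q' σ else Q (h :: σ))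
    ⟨max C C', fun h σ s j => by
      by_cases hh : h = h₀
      · simpa [hh] using Or.inr (hC' σ s j)
      · simpa [hh] using Or.inl (hC (h :: σ) s j)⟩
    (fun h σ s j => by
      by_cases hh : h = h₀
      · simpa [hh] using hV' σ s j
      · simpa [hh] using hV (h :: σ) s j)
    (fun h σ s a j => by
      by_cases hh : h = h₀
      · simpa [hh, devAfter] using hQ' σ s a j
      · simpa [hh, devAfter, noDev] using hQ (h :: σ) s a j)
  exact ⟨W, R, hWR, fun σ => by simp [hR]⟩

lemma IsValueFn.tail {π : Hist S A n → S → (Fin (n + 1) → A) → ℝ}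
    {i : Fin (n + 1)} {V : Hist S A n → S → Fin (n + 1) → ℝ}
    {Q : Hist S A n → S → (Fin (n + 1) → A) → Fin (n + 1) → ℝ}
    (h : IsValueFn G π i noDev V Q) (h₀ : S × (Fin (n + 1) → A) × (Fin (n + 1) → A)) :
    IsValueFn G (fun σ => π (h₀ :: σ)) i noDev (fun σ => V (h₀ :: σ)) (fun σ => Q (h₀ :: σ)) :=
  ⟨h.1.imp fun _ hC σ => hC (h₀ :: σ), fun σ => h.2.1 (h₀ :: σ), fun σ => h.2.2 (h₀ :: σ)⟩

variable [DecidableEq A]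

lemma IsCE.tail {δ : ℝ} {π : Hist S A n → S → (Fin (n + 1) → A) → ℝ} (hπ : IsCE G δ π)
    {V : Hist S A n → S → Fin (n + 1) → ℝ}
    {Q : Hist S A n → S → (Fin (n + 1) → A) → Fin (n + 1) → ℝ}
    (h : IsValueFn G π 0 noDev V Q) (h₀ : S × (Fin (n + 1) → A) × (Fin (n + 1) → A)) :
    IsCE G δ (fun σ => π (h₀ :: σ)) := by
  refine ⟨fun σ => hπ.1 (h₀ :: σ), fun V' Q' h' i hi ρ Vρ Qρ hρ σ s a => ?_⟩
  obtain ⟨W, R, hW, hR⟩ := h.exists_extend h₀ h'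
  obtain ⟨Wρ, Rρ, hWρ, hRρ⟩ := (h.noDev_congr i).exists_extend h₀ hρ
  rw [devAfter_noDev] at hW
  simpa only [hR, hRρ] using hπ.2 W R hW i hi _ Wρ Rρ hWρ (h₀ :: σ) s a

/-- Every exact equilibrium satisfies the one-step incentive constraint at its root. -/
lemma IsCE.icc {π : Hist S A n → S → (Fin (n + 1) → A) → ℝ} (hπ : IsCE G 0 π)
    {V : Hist S A n → S → Fin (n + 1) → ℝ}
    {Q : Hist S A n → S → (Fin (n + 1) → A) → Fin (n + 1) → ℝ}
    (h : IsValueFn G π 0 noDev V Q) (s : S) :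
    ICC G s (π [] s) (fun a b => V [(s, a, b)]) := by
  intro i hi a b
  let ρ : Hist S A n → S → A → A
    | [] => fun _ _ => b
    | _ :: _ => fun _ c => c
  have h' := h.noDev_congr i
  obtain ⟨V', Q', hρ, hV', -⟩ := exists_isValueFn_of_nonempty (G := G) (π := π) (i := i) (ρ := ρ)
    (h.1.imp fun _ hC h σ => hC (h :: σ)) (fun h₀ σ => h'.2.1 (h₀ :: σ))
    (fun h₀ σ => h'.2.2 (h₀ :: σ))
  have := hπ.2 V Q h i hi ρ V' Q' hρ [] s a
  simpa only [h.2.2, hρ.2.2, ρ, noDev, Function.update_eq_self, List.nil_append, hV', sub_zero]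
    using this

lemma Vstar_subset_Phi_Vstar (s : S) : Vstar G s ⊆ Phi G (Vstar G) s := by
  rintro v ⟨π, V, Q, hπ, h, rfl⟩
  refine ⟨π [] s, fun a b => V [(s, a, b)], ⟨hπ.1 [] s, hπ.icc h s, fun a b s' => ?_⟩, ?_⟩
  · exact ⟨_, _, _, hπ.tail h (s, a, b), h.tail (s, a, b), rfl⟩
  · funext j
    simp only [h.2.1 [], h.2.2 [], noDev, Function.update_eq_self, List.nil_append, Bellman]

lemma Vstar_subset_cube (hG : G.Valid) (s : S) : Vstar G s ⊆ cube n := by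
  rintro v ⟨π, V, Q, hπ, h, rfl⟩ j
  exact h.abs_le_half hG hπ.1 [] s j

lemma Phi_mono {X Y : S → Set (Fin (n + 1) → ℝ)} (hXY : ∀ s, X s ⊆ Y s) (s : S) :
    Phi G X s ⊆ Phi G Y s := by
  rintro v ⟨pb, w, ⟨hpb, hic, hw⟩, rfl⟩
  exact ⟨pb, w, ⟨hpb, hic, fun a b s' => hXY s' (hw a b s')⟩, rfl⟩

lemma Phi_subset_cube (hG : G.Valid) {X : S → Set (Fin (n + 1) → ℝ)}
    (hX : ∀ s, X s ⊆ cube n) (s : S) : Phi G X s ⊆ cube n := by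
  rintro v ⟨pb, w, ⟨hpb, -, hw⟩, rfl⟩ j
  refine hpb.abs_sum_le fun a => ?_
  refine (hG.abs_stage_le s a j fun s' => hX s' (hw a a s') j).trans (le_of_eq ?_)
  ring

end

/-- Lemma 4.6: value-set iteration started from the hypercube
`B` produces a nested sequence, all of whose members contain `𝒱*`. -/
theorem stmt4 {S A : Type*} [Fintype S] [Fintype A] [DecidableEq A] {n : ℕ}
    (G : Game S A n) (hG : G.Valid)
    (Vseq : ℕ → S → Set (Fin (n + 1) → ℝ))
    (h0 : ∀ s, Vseq 0 s = cube n)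
    (hsucc : ∀ k, Vseq (k + 1) = Phi G (Vseq k)) :
    ∀ k s, Vseq (k + 1) s ⊆ Vseq k s ∧ Vstar G s ⊆ Vseq (k + 1) s := by
  have hstar : ∀ k s, Vstar G s ⊆ Vseq k s := by
    intro k
    induction k with
    | zero => exact fun s => (h0 s).symm ▸ Vstar_subset_cube hG s
    | succ k ih =>
      intro s
      rw [hsucc]
      exact (Vstar_subset_Phi_Vstar s).trans (Phi_mono ih s)
  have hnest : ∀ k s, Vseq (k + 1) s ⊆ Vseq k s := by
    intro k
    induction k with
    | zero =>
      intro s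
      rw [hsucc, h0 s]
      exact Phi_subset_cube hG (fun s => (h0 s).subset) s
    | succ k ih =>
      intro s
      rw [hsucc (k + 1), hsucc k]
      exact Phi_mono (by rw [← hsucc k]; exact ih) s
  exact fun k s => ⟨hnest k s, hstar (k + 1) s⟩
end

section
/- Fixed points of Φ̂ are approximately fixed under Φ (Corollary 4.9): If a value-set function 𝒱 satisfies 𝒱 = Φ̂(𝒱), then Φ(𝒱) ⊆ 𝒱 ⊆ neigh_ξ(Φ(𝒱)), i.e., Φ(𝒱)(s) ⊆ 𝒱(s) ⊆ neigh_ξ(Φ(𝒱)(s)) for every state s ∈ S. -/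
open Finset

theorem convexHull_grid_nhds {n : ℕ} {ξ : ℝ} (hξ : 0 < ξ) (v : Fin (n + 1) → ℝ) :
    v ∈ convexHull ℝ ({v' | ∀ i, |v' i - v i| ≤ ξ} ∩ grid n ξ) := by
  have hfl : ∀ x : ℝ, ξ * (⌊x / ξ⌋ : ℝ) ≤ x ∧ x < ξ * (⌊x / ξ⌋ : ℝ) + ξ := by
    intro x
    have h1 := Int.floor_le (x / ξ)
    have h2 := Int.lt_floor_add_one (x / ξ)
    rw [le_div_iff₀ hξ] at h1
    rw [div_lt_iff₀ hξ] at h2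
    constructor <;> linarith
  have hmem : v ∈ convexHull ℝ (Set.univ.pi fun i =>
      ({ξ * (⌊v i / ξ⌋ : ℝ), ξ * (⌊v i / ξ⌋ : ℝ) + ξ} : Set ℝ)) := by
    rw [convexHull_pi]
    intro i _
    beta_reduce
    rw [convexHull_pair, segment_eq_Icc (by linarith)]
    exact ⟨(hfl _).1, (hfl _).2.le⟩
  refine convexHull_mono ?_ hmem
  refine fun x hx => ⟨fun i => ?_, fun i => ?_⟩
  · have := hfl (v i)
    rcases hx i trivial with h | h
    · rw [h, abs_le]; constructor <;> linarith
    · rw [Set.mem_singleton_iff.mp h, abs_le]; constructor <;> linarith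
  · rcases hx i trivial with h | h
    · exact ⟨_, h⟩
    · exact ⟨⌊v i / ξ⌋ + 1, by rw [Set.mem_singleton_iff.mp h]; push_cast; ring⟩

theorem subset_convexHull_neigh_inter_grid {n : ℕ} {ξ : ℝ} (hξ : 0 < ξ)
    (X : Set (Fin (n + 1) → ℝ)) : X ⊆ convexHull ℝ (neigh ξ X ∩ grid n ξ) :=
  fun v hv =>
    have h : {v' | ∀ i, |v' i - v i| ≤ ξ} ⊆ neigh ξ X := fun _ h => ⟨v, hv, h⟩
    convexHull_mono (Set.inter_subset_inter_left _ h) (convexHull_grid_nhds hξ v)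

theorem Convex.neigh {n : ℕ} {ξ : ℝ} {X : Set (Fin (n + 1) → ℝ)} (hX : Convex ℝ X) :
    Convex ℝ (neigh ξ X) := by
  rintro x ⟨v, hv, hxv⟩ y ⟨w, hw, hyw⟩ t u ht hu htu
  refine ⟨t • v + u • w, hX hv hw ht hu htu, fun i => ?_⟩
  have h1 := abs_le.mp (hxv i)
  have h2 := abs_le.mp (hyw i)
  obtain rfl : u = 1 - t := by linarith
  simp only [Pi.add_apply, Pi.smul_apply, smul_eq_mul]
  rw [abs_le]
  constructor <;> nlinarith

theorem IsDist.convexCombo {X : Type*} [Fintype X] {f g : X → ℝ} (hf : IsDist f)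
    (hg : IsDist g) {t u : ℝ} (ht : 0 ≤ t) (hu : 0 ≤ u) (htu : t + u = 1) :
    IsDist fun x => t * f x + u * g x := by
  refine ⟨fun x => add_nonneg (mul_nonneg ht (hf.1 x)) (mul_nonneg hu (hg.1 x)), ?_⟩
  rw [sum_add_distrib, ← mul_sum, ← mul_sum, hf.2, hg.2, mul_one, mul_one, htu]

theorem Convex.exists_weighted_average {E : Type*} [AddCommGroup E] [Module ℝ E] {K : Set E}
    (hK : Convex ℝ K) {x y : E} (hx : x ∈ K) (hy : y ∈ K) {c d : ℝ} (hc : 0 ≤ c)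
    (hd : 0 ≤ d) : ∃ z ∈ K, (c + d) • z = c • x + d • y := by
  rcases (add_nonneg hc hd).eq_or_lt with h | h
  · obtain rfl : c = 0 := by linarith
    obtain rfl : d = 0 := by linarith
    exact ⟨x, hx, by simp⟩
  · refine ⟨(c / (c + d)) • x + (d / (c + d)) • y,
      hK hx hy (by positivity) (by positivity) (by field_simp), ?_⟩
    rw [smul_add, smul_smul, smul_smul, mul_div_cancel₀ _ h.ne', mul_div_cancel₀ _ h.ne']

theorem convex_Phi {S A : Type*} [Fintype S] [Fintype A] [DecidableEq A] {n : ℕ}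
    (G : Game S A n) {VS : S → Set (Fin (n + 1) → ℝ)} (hVS : ∀ s, Convex ℝ (VS s)) (s : S) :
    Convex ℝ (Phi G VS s) := by
  rintro _ ⟨p₁, w₁, ⟨hp₁, hic₁, hw₁⟩, rfl⟩ _ ⟨p₂, w₂, ⟨hp₂, hic₂, hw₂⟩, rfl⟩ t u ht hu htu
  dsimp only at hp₁ hp₂ hic₁ hic₂ hw₁ hw₂
  choose w hw hwe using fun a b s' => (hVS s').exists_weighted_average (hw₁ a b s') (hw₂ a b s')
    (mul_nonneg ht (hp₁.1 a)) (mul_nonneg hu (hp₂.1 a))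
  have key : ∀ (a b : Fin (n + 1) → A) (j : Fin (n + 1)) (R : ℝ) (q : S → ℝ),
      (t * p₁ a + u * p₂ a) * (R + G.gamma * ∑ s', q s' * w a b s' j) =
        t * (p₁ a * (R + G.gamma * ∑ s', q s' * w₁ a b s' j)) +
          u * (p₂ a * (R + G.gamma * ∑ s', q s' * w₂ a b s' j)) := by
    intro a b j R q
    have hsum : (t * p₁ a + u * p₂ a) * ∑ s', q s' * w a b s' j =
        t * p₁ a * ∑ s', q s' * w₁ a b s' j + u * p₂ a * ∑ s', q s' * w₂ a b s' j := by
      simp only [mul_sum, ← sum_add_distrib]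
      refine sum_congr rfl fun s' _ => ?_
      have h := congrFun (hwe a b s') j
      simp only [Pi.add_apply, Pi.smul_apply, smul_eq_mul] at h
      linear_combination q s' * h
    linear_combination G.gamma * hsum
  refine ⟨fun a => t * p₁ a + u * p₂ a, w, ⟨hp₁.convexCombo hp₂ ht hu htu, ?_, hw⟩, ?_⟩
  · intro i hi a b
    simp only [key, sum_add_distrib, ← mul_sum]
    exact add_le_add (mul_le_mul_of_nonneg_left (hic₁ i hi a b) ht)
      (mul_le_mul_of_nonneg_left (hic₂ i hi a b) hu)
  · funext j
    simp only [Bellman, key, sum_add_distrib, ← mul_sum, Pi.add_apply, Pi.smul_apply, smul_eq_mul]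

/-- Corollary 4.9: fixed points of `Φ̂` are approximately
fixed under `Φ`: `Φ(𝒱) ⊆ 𝒱 ⊆ neigh_ξ(Φ(𝒱))`. -/
theorem stmt7 {S A : Type*} [Fintype S] [Fintype A] [DecidableEq A] {n : ℕ}
    (G : Game S A n) (hG : G.Valid) (ε δ ξ : ℝ) (hε : 0 < ε) (hδ : 0 < δ)
    (hξ : ξ = (1 - G.gamma) * min ε (δ / 2))
    (hdiv : ∃ m : ℕ, (1 / 2 : ℝ) = (m : ℝ) * ξ)
    (VS : S → Set (Fin (n + 1) → ℝ)) (hfix : ∀ s, VS s = PhiHat G ξ VS s) :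
    ∀ s, Phi G VS s ⊆ VS s ∧ VS s ⊆ neigh ξ (Phi G VS s) := by
  have hpos : 0 < ξ := by
    rw [hξ]
    exact mul_pos (sub_pos.mpr hG.2.1) (lt_min hε (half_pos hδ))
  have hconv : ∀ s, Convex ℝ (VS s) := fun s => by
    rw [hfix s]
    exact convex_convexHull ℝ _
  intro s
  constructor
  · rw [hfix s]
    exact subset_convexHull_neigh_inter_grid hpos _
  · exact (hfix s).subset.trans
      (convexHull_min Set.inter_subset_left (convex_Phi G hconv s).neigh)
end
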